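/- In t_A(n+1) (index set {0,1,…,n}), fix 1 ≤ k ≤ n and set d_k := −Σ_{l=1}^{k} Σ_{c=0}^{l−1} t_{cl} − (1/2) Σ_{1≤i≤k<j≤n} t_{ij}. Then [d_k, t_{ij}] = 0 whenever 1 ≤ i < j ≤ k, and [d_k, t_{ij}] = 0 whenever k+1 ≤ i < j ≤ n. -/

import Mathlib

open FreeLieAlgebra

noncomputable section

/-- The free Lie algebra on generators `t_{ij}`, `i, j ∈ {0, …, N-1}`. -/
abbrev FA (N : ℕ) := FreeLieAlgebra ℂ (Fin N × Fin N)

/-- The defining relations of the type-A holonomy Lie algebra `t_A(N)` on the index set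
`{0, 1, …, N-1}`: symmetry `t_{ij} = t_{ji}` (with `t_{ii} = 0`, so that the actual
generators are `t_{ij}` for `i < j`), `[t_{ij}, t_{ik} + t_{jk}] = 0` for pairwise distinct
`i, j, k`, and `[t_{ij}, t_{kl}] = 0` for `{i,j} ∩ {k,l} = ∅`. -/
def tARel (N : ℕ) : Set (FA N) :=
  {x | (∃ i j : Fin N, x = FreeLieAlgebra.of ℂ ((i, j) : Fin N × Fin N) -
          FreeLieAlgebra.of ℂ ((j, i) : Fin N × Fin N)) ∨
    (∃ i : Fin N, x = FreeLieAlgebra.of ℂ ((i, i) : Fin N × Fin N)) ∨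
    (∃ i j k : Fin N, i ≠ j ∧ i ≠ k ∧ j ≠ k ∧
      x = ⁅FreeLieAlgebra.of ℂ ((i, j) : Fin N × Fin N),
           FreeLieAlgebra.of ℂ ((i, k) : Fin N × Fin N) +
           FreeLieAlgebra.of ℂ ((j, k) : Fin N × Fin N)⁆) ∨
    (∃ i j k l : Fin N, i ≠ k ∧ i ≠ l ∧ j ≠ k ∧ j ≠ l ∧
      x = ⁅FreeLieAlgebra.of ℂ ((i, j) : Fin N × Fin N),
           FreeLieAlgebra.of ℂ ((k, l) : Fin N × Fin N)⁆)}

/-- The Lie ideal generated by the relations of `t_A(N)`. -/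
def tAIdeal (N : ℕ) : LieIdeal ℂ (FA N) := LieSubmodule.lieSpan ℂ (FA N) (tARel N)

/-- The type-A holonomy Lie algebra `t_A(N)` (the holonomy Lie algebra of the root system
`A_{N-1}`), on the index set `{0, 1, …, N-1}`. -/
abbrev tA (N : ℕ) := FA N ⧸ tAIdeal N

/-- The image of the generator `t_{ij}` in `t_A(N)`. -/
def tgenA (N : ℕ) (i j : Fin N) : tA N :=
  LieSubmodule.Quotient.mk' (tAIdeal N) (FreeLieAlgebra.of ℂ ((i, j) : Fin N × Fin N))

/-- The element
`d_k = -∑_{l=1}^{k} ∑_{c=0}^{l-1} t_{cl} - (1/2) ∑_{1 ≤ i ≤ k < j ≤ n} t_{ij} ∈ t_A(n+1)`. -/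
def dElt (n k : ℕ) : tA (n + 1) :=
  -(∑ p ∈ Finset.univ.filter
      (fun p : Fin (n + 1) × Fin (n + 1) => p.1 < p.2 ∧ (p.2 : ℕ) ≤ k),
      tgenA (n + 1) p.1 p.2) -
    (2⁻¹ : ℂ) • ∑ p ∈ Finset.univ.filter
      (fun p : Fin (n + 1) × Fin (n + 1) =>
        1 ≤ (p.1 : ℕ) ∧ (p.1 : ℕ) ≤ k ∧ k < (p.2 : ℕ)),
      tgenA (n + 1) p.1 p.2

theorem tgenA_symm (N : ℕ) (i j : Fin N) : tgenA N i j = tgenA N j i := by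
  rw [tgenA, tgenA, ← sub_eq_zero, ← map_sub]
  exact LieSubmodule.Quotient.mk_eq_zero'.mpr
    (LieSubmodule.subset_lieSpan (Or.inl ⟨i, j, rfl⟩))

theorem tgenA_self (N : ℕ) (i : Fin N) : tgenA N i i = 0 :=
  LieSubmodule.Quotient.mk_eq_zero'.mpr
    (LieSubmodule.subset_lieSpan (Or.inr (Or.inl ⟨i, rfl⟩)))

theorem tgenA_lie_add {N : ℕ} {i j k : Fin N} (hij : i ≠ j) (hik : i ≠ k) (hjk : j ≠ k) :
    ⁅tgenA N i j, tgenA N i k + tgenA N j k⁆ = 0 :=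
  LieSubmodule.Quotient.mk_eq_zero'.mpr
    (LieSubmodule.subset_lieSpan (Or.inr (Or.inr (Or.inl ⟨i, j, k, hij, hik, hjk, rfl⟩))))

theorem tgenA_lie_of_disjoint {N : ℕ} {i j k l : Fin N} (hik : i ≠ k) (hil : i ≠ l)
    (hjk : j ≠ k) (hjl : j ≠ l) : ⁅tgenA N i j, tgenA N k l⁆ = 0 :=
  LieSubmodule.Quotient.mk_eq_zero'.mpr
    (LieSubmodule.subset_lieSpan
      (Or.inr (Or.inr (Or.inr ⟨i, j, k, l, hik, hil, hjk, hjl, rfl⟩))))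

/-- Applying the transposition `(i j)` to the indices of `t_{pq}` negates `[t_{ij}, t_{pq}]`. -/
theorem tgenA_lie_swap {N : ℕ} {i j : Fin N} (hij : i ≠ j) (p q : Fin N) :
    ⁅tgenA N i j, tgenA N (Equiv.swap i j p) (Equiv.swap i j q)⁆ =
      -⁅tgenA N i j, tgenA N p q⁆ := by
  have key : ∀ r, r ≠ i → r ≠ j →
      ⁅tgenA N i j, tgenA N j r⁆ = -⁅tgenA N i j, tgenA N i r⁆ := fun r hi hj => by
    have h := tgenA_lie_add hij hi.symm hj.symm
    rw [lie_add] at h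
    exact eq_neg_of_add_eq_zero_right h
  have key' : ∀ r, r ≠ i → r ≠ j →
      ⁅tgenA N i j, tgenA N i r⁆ = -⁅tgenA N i j, tgenA N j r⁆ := fun r hi hj => by
    rw [key r hi hj, neg_neg]
  by_cases hpi : p = i
  · subst hpi
    by_cases hqp : q = p
    · subst hqp; simp [tgenA_self]
    by_cases hqj : q = j
    · subst hqj; simp [tgenA_symm N q p]
    · rw [Equiv.swap_apply_left, Equiv.swap_apply_of_ne_of_ne hqp hqj, key q hqp hqj]
  by_cases hpj : p = j
  · subst hpj
    by_cases hqp : q = p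
    · subst hqp; simp [tgenA_self]
    by_cases hqi : q = i
    · subst hqi; simp [tgenA_symm N p q]
    · rw [Equiv.swap_apply_right, Equiv.swap_apply_of_ne_of_ne hqi hqp, key' q hqi hqp]
  rw [Equiv.swap_apply_of_ne_of_ne hpi hpj]
  by_cases hqi : q = i
  · subst hqi
    rw [Equiv.swap_apply_left, tgenA_symm N p j, tgenA_symm N p q, key p hpi hpj]
  by_cases hqj : q = j
  · subst hqj
    rw [Equiv.swap_apply_right, tgenA_symm N p i, tgenA_symm N p q, key' p hpi hpj]
  rw [Equiv.swap_apply_of_ne_of_ne hqi hqj,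
    tgenA_lie_of_disjoint (Ne.symm hpi) (Ne.symm hqi) (Ne.symm hpj) (Ne.symm hqj), neg_zero]

/-- `t_{ij}` commutes with the sum of the `t_{pq}` over a set of pairs that is stable under the
transposition `(i j)`. -/
theorem tgenA_lie_sum_eq_zero {N : ℕ} {i j : Fin N} (hij : i ≠ j) (P : Fin N × Fin N → Prop)
    [DecidablePred P]
    (hP : ∀ p q, P (Equiv.swap i j p, Equiv.swap i j q) ↔ P (p, q)) :
    ⁅tgenA N i j, ∑ p ∈ Finset.univ.filter P, tgenA N p.1 p.2⁆ = 0 := by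
  have : IsAddTorsionFree (tA N) := .of_isTorsionFree ℂ _
  rw [lie_sum]
  refine self_eq_neg.mp ?_
  rw [← Finset.sum_neg_distrib]
  refine Finset.sum_equiv ((Equiv.swap i j).prodCongr (Equiv.swap i j)) ?_ ?_
  · rintro ⟨p, q⟩
    simp [hP]
  · rintro ⟨p, q⟩ -
    simp [tgenA_lie_swap hij]

/-- `t_{ij}` commutes with the sum of the `t_{pq}` over the pairs `p < q` in a set of indices
that is stable under the transposition `(i j)`. -/
theorem tgenA_lie_sum_lt_eq_zero {N : ℕ} {i j : Fin N} (hij : i ≠ j) (Q : Fin N → Prop)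
    [DecidablePred Q] (hQ : ∀ p, Q (Equiv.swap i j p) ↔ Q p) :
    ⁅tgenA N i j, ∑ p ∈ Finset.univ.filter
      (fun p : Fin N × Fin N => p.1 < p.2 ∧ Q p.1 ∧ Q p.2), tgenA N p.1 p.2⁆ = 0 := by
  have h := tgenA_lie_sum_eq_zero hij (fun p => p.1 ≠ p.2 ∧ Q p.1 ∧ Q p.2)
    (by simp [hQ])
  have hsplit : ∑ p ∈ Finset.univ.filter
        (fun p : Fin N × Fin N => p.1 ≠ p.2 ∧ Q p.1 ∧ Q p.2), tgenA N p.1 p.2 =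
      ∑ p ∈ Finset.univ.filter
        (fun p : Fin N × Fin N => p.1 < p.2 ∧ Q p.1 ∧ Q p.2), tgenA N p.1 p.2 +
      ∑ p ∈ Finset.univ.filter
        (fun p : Fin N × Fin N => p.2 < p.1 ∧ Q p.1 ∧ Q p.2), tgenA N p.1 p.2 := by
    rw [← Finset.sum_union]
    · congr 1
      ext p
      simp only [Finset.mem_filter, Finset.mem_univ, true_and, Finset.mem_union, ne_iff_lt_or_gt]
      tauto
    · refine Finset.disjoint_filter.mpr fun p _ h h' => ?_
      exact lt_asymm h.1 h'.1
  have hflip : ∑ p ∈ Finset.univ.filter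
        (fun p : Fin N × Fin N => p.2 < p.1 ∧ Q p.1 ∧ Q p.2), tgenA N p.1 p.2 =
      ∑ p ∈ Finset.univ.filter
        (fun p : Fin N × Fin N => p.1 < p.2 ∧ Q p.1 ∧ Q p.2), tgenA N p.1 p.2 := by
    refine Finset.sum_equiv (Equiv.prodComm _ _) ?_ ?_
    · rintro ⟨p, q⟩
      simp [and_comm]
    · rintro ⟨p, q⟩ -
      exact tgenA_symm N p q
  have : IsAddTorsionFree (tA N) := .of_isTorsionFree ℂ _
  rw [hsplit, hflip, lie_add] at h
  exact self_eq_neg.mp (eq_neg_of_add_eq_zero_left h)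

theorem pred_swap_apply_iff {α : Type*} [DecidableEq α] {i j : α} {Q : α → Prop} (h : Q i ↔ Q j)
    (p : α) : Q (Equiv.swap i j p) ↔ Q p := by
  rw [Equiv.swap_apply_def]
  split_ifs with h₁ h₂
  · rw [h₁, h]
  · rw [h₂, h]
  · rfl

/-- `t_{ij}` commutes with the second sum in `d_k` as soon as `i, j` lie in the same block. -/
theorem tgenA_lie_sum_blocks_eq_zero {N k : ℕ} {i j : Fin N} (hij : i ≠ j)
    (h₁ : 1 ≤ (i : ℕ)) (h₂ : 1 ≤ (j : ℕ)) (h : (i : ℕ) ≤ k ↔ (j : ℕ) ≤ k) :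
    ⁅tgenA N i j, ∑ p ∈ Finset.univ.filter
      (fun p : Fin N × Fin N => 1 ≤ (p.1 : ℕ) ∧ (p.1 : ℕ) ≤ k ∧ k < (p.2 : ℕ)),
      tgenA N p.1 p.2⁆ = 0 := by
  refine tgenA_lie_sum_eq_zero hij _ fun p q => ?_
  have ha := pred_swap_apply_iff (i := i) (j := j) (Q := fun r : Fin N => 1 ≤ (r : ℕ))
    (by simp [h₁, h₂]) p
  have hb := pred_swap_apply_iff (i := i) (j := j) (Q := fun r : Fin N => (r : ℕ) ≤ k) h
  simp only at ha hb ⊢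
  rw [ha, hb, ← not_le, ← not_le, hb]

/-- In `t_A(n+1)` (index set `{0, 1, …, n}`), for `1 ≤ k ≤ n` the element `d_k` commutes
with `t_{ij}` whenever `1 ≤ i < j ≤ k`, and with `t_{ij}` whenever `k+1 ≤ i < j ≤ n`. -/
theorem dElt_commutes (n k : ℕ) (hk1 : 1 ≤ k) (hkn : k ≤ n) :
    (∀ i j : Fin (n + 1), 1 ≤ (i : ℕ) → i < j → (j : ℕ) ≤ k →
      ⁅dElt n k, tgenA (n + 1) i j⁆ = 0) ∧
    (∀ i j : Fin (n + 1), k + 1 ≤ (i : ℕ) → i < j →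
      ⁅dElt n k, tgenA (n + 1) i j⁆ = 0) := by
  refine ⟨fun i j hi hij hj => ?_, fun i j hi hij => ?_⟩
  · have hlt : (i : ℕ) < j := hij
    have hs := tgenA_lie_sum_lt_eq_zero hij.ne (fun r : Fin (n + 1) => (r : ℕ) ≤ k)
      (pred_swap_apply_iff (Q := fun r : Fin (n + 1) => (r : ℕ) ≤ k) (iff_of_true (by omega) hj))
    have hfilter : ∀ p : Fin (n + 1) × Fin (n + 1),
        (p.1 < p.2 ∧ (p.1 : ℕ) ≤ k ∧ (p.2 : ℕ) ≤ k) ↔ (p.1 < p.2 ∧ (p.2 : ℕ) ≤ k) :=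
      fun p => by rw [Fin.lt_def]; omega
    simp only [hfilter] at hs
    rw [← lie_skew, dElt, lie_sub, lie_neg, lie_smul, hs,
      tgenA_lie_sum_blocks_eq_zero hij.ne hi (by omega) (by omega)]
    simp
  · have hlt : (i : ℕ) < j := hij
    rw [← lie_skew, dElt, lie_sub, lie_neg, lie_smul,
      tgenA_lie_sum_blocks_eq_zero hij.ne (by omega) (by omega) (by omega), lie_sum,
      Finset.sum_eq_zero]
    · simp
    · rintro ⟨p, q⟩ hp
      obtain ⟨hpq, hq⟩ := (Finset.mem_filter.mp hp).2
      simp only [Fin.lt_def] at hpq hq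
      apply tgenA_lie_of_disjoint <;> simp only [Ne, Fin.ext_iff] <;> omega

end
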